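/- Let p be an odd prime. The maps τ_{a,b}: (x,y) ↦ (x+a, y+b) for a,b ∈ F_p, μ: (x,y) ↦ (y,x), and θ_d: (x,y) ↦ (dx, d^{-1}y) for d ∈ F_p^* all preserve the equation (x^p−x)(y^p−y)=1, i.e., they induce automorphisms of the function field F_p(x,y) of the Artin-Mumford curve. Moreover the group they generate has order p²·2(p−1) and is isomorphic to (C_p × C_p) ⋊ D_{p−1}. -/

import Mathlib

open Polynomial in
/-- The integral equation over `F_p[x]` satisfied by `1 / y`. -/
noncomputable def artinMumfordPoly (p : ℕ) : (ZMod p)[X][X] :=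
  X ^ p + (C (X ^ p - X) * X ^ (p - 1) - C (X ^ p - X))

namespace artinMumfordPoly

open Polynomial

variable (p : ℕ) [hp : Fact p.Prime]

lemma degree_lower_lt :
    (C (X ^ p - X : (ZMod p)[X]) * X ^ (p - 1) - C (X ^ p - X)).degree < (p : WithBot ℕ) := by
  refine (degree_sub_le _ _).trans_lt (max_lt ?_ ?_)
  · refine (degree_C_mul_X_pow_le _ _).trans_lt ?_
    exact_mod_cast Nat.sub_lt hp.out.pos one_pos
  · exact degree_C_le.trans_lt (by exact_mod_cast hp.out.pos)

lemma monic : (artinMumfordPoly p).Monic :=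
  monic_X_pow_add (degree_lower_lt p)

lemma natDegree : (artinMumfordPoly p).natDegree = p := by
  refine natDegree_eq_of_degree_eq_some ?_
  rw [artinMumfordPoly, degree_add_eq_left_of_degree_lt, degree_X_pow]
  rw [degree_X_pow]
  exact degree_lower_lt p

lemma irreducible : Irreducible (artinMumfordPoly p) := by
  have h1 := hp.out.one_lt
  have hprime : (Ideal.span {(X : (ZMod p)[X])}).IsPrime :=
    (Ideal.span_singleton_prime X_ne_zero).2 prime_X
  have hX : (X : (ZMod p)[X]) ∣ X ^ p - X :=
    dvd_sub (dvd_pow_self _ hp.out.ne_zero) dvd_rfl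
  refine ((monic p).isEisensteinAt_of_mem_of_notMem hprime.ne_top ?_ ?_).irreducible hprime
    (monic p).isPrimitive ((natDegree p).symm ▸ hp.out.pos)
  · intro n hn
    rw [natDegree] at hn
    rw [Ideal.mem_span_singleton, artinMumfordPoly, coeff_add, coeff_X_pow, if_neg hn.ne, zero_add,
      coeff_sub, coeff_C_mul, coeff_C]
    refine dvd_sub (hX.mul_right _) ?_
    split_ifs
    · exact hX
    · exact dvd_zero _
  · have h0 : (artinMumfordPoly p).coeff 0 = -(X ^ p - X) := by
      rw [artinMumfordPoly, coeff_add, coeff_sub, coeff_C_mul, coeff_C_zero]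
      simp [coeff_X_pow, hp.out.ne_zero.symm, (Nat.sub_pos_of_lt h1).ne]
    rw [h0, Ideal.span_singleton_pow, Ideal.mem_span_singleton, dvd_neg, X_pow_dvd_iff]
    intro h
    have := h 1 one_lt_two
    simp [coeff_X_pow, h1.ne] at this

variable {p} {F : Type*} [Field F] [Algebra (ZMod p) F]

lemma aevalAeval_eq {x w : F} :
    aevalAeval x w (artinMumfordPoly p)
      = w ^ p + ((x ^ p - x) * w ^ (p - 1) - (x ^ p - x)) := by
  simp [artinMumfordPoly]

/-- The polynomials vanishing at a generic point of the curve are the multiples of its equation. -/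
lemma aevalAeval_eq_zero_iff {x w : F} (hx : Transcendental (ZMod p) x)
    (hw : aevalAeval x w (artinMumfordPoly p) = 0) (q : (ZMod p)[X][X]) :
    aevalAeval x w q = 0 ↔ artinMumfordPoly p ∣ q := by
  let _ : Algebra (ZMod p)[X] F := (aeval x).toAlgebra
  have hinj : Function.Injective (algebraMap (ZMod p)[X] F) :=
    transcendental_iff_injective.1 hx
  have : Module.IsTorsionFree (ZMod p)[X] F :=
    Module.isTorsionFree_iff_algebraMap_injective.mpr hinj
  have heq (q : (ZMod p)[X][X]) : aevalAeval x w q = aeval w q := by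
    induction q using Polynomial.induction_on' with
    | add q r hq hr => rw [map_add, map_add, hq, hr]
    | monomial n a =>
      rw [← C_mul_X_pow_eq_monomial, map_mul, map_mul, map_pow, map_pow, aevalAeval_C,
        aevalAeval_Y, aeval_C, aeval_X]
      rfl
  have hint : IsIntegral (ZMod p)[X] w := ⟨_, monic p, by rw [← aeval_def, ← heq, hw]⟩
  have hmin : minpoly (ZMod p)[X] w = artinMumfordPoly p := by
    obtain ⟨c, hc⟩ := minpoly.isIntegrallyClosed_dvd hint ((heq _).symm.trans hw)
    have hcu := ((irreducible p).isUnit_or_isUnit hc).resolve_left (minpoly.not_isUnit _ _)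
    exact eq_of_monic_of_associated (minpoly.monic hint) (monic p)
      ⟨hcu.unit, hc.symm⟩
  rw [heq, minpoly.isIntegrallyClosed_dvd_iff hint, hmin]

end artinMumfordPoly

section Curve

open Polynomial

variable {p : ℕ} [hp : Fact p.Prime] {F : Type*} [Field F] [Algebra (ZMod p) F] {x y : F}

lemma aevalAeval_artinMumfordPoly (hrel : (x ^ p - x) * (y ^ p - y) = 1) :
    aevalAeval x y⁻¹ (artinMumfordPoly p) = 0 := by
  have hy : y ≠ 0 := by
    rintro rfl
    simp [hp.out.ne_zero] at hrel
  rw [artinMumfordPoly.aevalAeval_eq]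
  obtain ⟨n, hn⟩ := Nat.exists_eq_add_one.2 hp.out.pos
  rw [hn] at hrel ⊢
  rw [Nat.add_sub_cancel]
  have h1 : y * y⁻¹ = 1 := mul_inv_cancel₀ hy
  have hn1 : y ^ n * y⁻¹ ^ n = 1 := by rw [← mul_pow, h1, one_pow]
  refine (mul_eq_zero.1 ?_).resolve_left (pow_ne_zero (n + 1) hy)
  generalize y⁻¹ = w at *
  linear_combination (y * w + (x ^ (n + 1) - x) * y) * hn1 + h1 - hrel

lemma ArtinMumford.algHom_ext {K : Type*} [Field K] [Algebra (ZMod p) K]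
    (hgen : IntermediateField.adjoin (ZMod p) {x, y} = ⊤)
    {σ τ : F →ₐ[ZMod p] K} (h1 : σ x = τ x) (h2 : σ y = τ y) : σ = τ := by
  ext z
  have hz : z ∈ IntermediateField.adjoin (ZMod p) {x, y} := hgen ▸ IntermediateField.mem_top
  induction hz using IntermediateField.adjoin_induction with
  | mem z hz =>
    rcases hz with rfl | rfl
    · exact h1
    · exact h2
  | algebraMap a => rw [σ.commutes, τ.commutes]
  | add a b _ _ ha hb => rw [map_add, map_add, ha, hb]
  | inv a _ ha => rw [map_inv₀, map_inv₀, ha]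
  | mul a b _ _ ha hb => rw [map_mul, map_mul, ha, hb]

/-- Two generic points of the Artin–Mumford curve are related by an endomorphism. -/
lemma ArtinMumford.exists_algHom (hx : Transcendental (ZMod p) x)
    (hrel : (x ^ p - x) * (y ^ p - y) = 1)
    (hgen : IntermediateField.adjoin (ZMod p) {x, y} = ⊤) {x' y' : F}
    (hx' : Transcendental (ZMod p) x') (hrel' : (x' ^ p - x') * (y' ^ p - y') = 1) :
    ∃ σ : F →ₐ[ZMod p] F, σ x = x' ∧ σ y = y' := by
  let f : (ZMod p)[X][X] →ₐ[ZMod p] F := aevalAeval x y⁻¹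
  let g : (ZMod p)[X][X] →ₐ[ZMod p] F := aevalAeval x' y'⁻¹
  have hfg (q) : g q = 0 ↔ f q = 0 :=
    (artinMumfordPoly.aevalAeval_eq_zero_iff hx' (aevalAeval_artinMumfordPoly hrel') q).trans
      (artinMumfordPoly.aevalAeval_eq_zero_iff hx (aevalAeval_artinMumfordPoly hrel) q).symm
  have hfx : f (C X) = x := aevalAeval_X _ _
  have hfy : f X = y⁻¹ := aevalAeval_Y _ _
  have hfrac (z : F) : ∃ a b : f.range, z = algebraMap f.range F a / algebraMap f.range F b := by
    have hz : z ∈ IntermediateField.adjoin (ZMod p) {x, y⁻¹} := by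
      have : IntermediateField.adjoin (ZMod p) {x, y⁻¹} = ⊤ := by
        rw [eq_top_iff, ← hgen, IntermediateField.adjoin_le_iff]
        rintro _ (rfl | rfl)
        · exact IntermediateField.subset_adjoin _ _ (by simp)
        · rw [SetLike.mem_coe, ← inv_mem_iff]
          exact IntermediateField.subset_adjoin _ _ (by simp)
      exact this ▸ IntermediateField.mem_top
    have hle : Algebra.adjoin (ZMod p) {x, y⁻¹} ≤ f.range := by
      rw [Algebra.adjoin_le_iff]
      rintro _ (rfl | rfl)
      · exact ⟨_, hfx⟩
      · exact ⟨_, hfy⟩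
    obtain ⟨a, ha, b, hb, rfl⟩ := IntermediateField.mem_adjoin_iff_div.1 hz
    exact ⟨⟨a, hle ha⟩, ⟨b, hle hb⟩, rfl⟩
  have : IsFractionRing f.range F := .of_field _ _ hfrac
  let h : f.range →ₐ[ZMod p] F :=
    (Ideal.Quotient.liftₐ (RingHom.ker f.rangeRestrict) g fun q hq =>
      (hfg q).2 (congrArg Subtype.val hq)).comp
      (Ideal.quotientKerAlgEquivOfSurjective f.rangeRestrict_surjective).symm.toAlgHom
  have hh (q) : h (f.rangeRestrict q) = g q := by
    have : (Ideal.quotientKerAlgEquivOfSurjective f.rangeRestrict_surjective).symm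
        (f.rangeRestrict q) = Ideal.Quotient.mk _ q := by
      rw [AlgEquiv.symm_apply_eq]; rfl
    exact congrArg (Ideal.Quotient.liftₐ (RingHom.ker f.rangeRestrict) g fun q hq =>
      (hfg q).2 (congrArg Subtype.val hq)) this
  have hinj : Function.Injective h := by
    rw [injective_iff_map_eq_zero]
    intro a ha
    obtain ⟨q, rfl⟩ := f.rangeRestrict_surjective a
    rw [hh, hfg] at ha
    exact Subtype.ext ha
  let σ : F →ₐ[ZMod p] F := IsFractionRing.liftAlgHom (A := f.range) (g := h) hinj
  have hσ (q) : σ (f q) = g q :=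
    (IsFractionRing.lift_algebraMap (A := f.range) (K := F) (g := h.toRingHom) hinj
      (f.rangeRestrict q)).trans (hh q)
  refine ⟨σ, ?_, ?_⟩
  · rw [← hfx, hσ]
    exact aevalAeval_X _ _
  · rw [← inv_inj, ← map_inv₀, ← hfy, hσ]
    exact aevalAeval_Y _ _

/-- A generic point of the Artin–Mumford curve generating the function field determines an
automorphism. -/
lemma ArtinMumford.exists_algEquiv (hx : Transcendental (ZMod p) x)
    (hrel : (x ^ p - x) * (y ^ p - y) = 1)
    (hgen : IntermediateField.adjoin (ZMod p) {x, y} = ⊤) {x' y' : F}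
    (hx' : Transcendental (ZMod p) x') (hrel' : (x' ^ p - x') * (y' ^ p - y') = 1)
    (hxm : x ∈ IntermediateField.adjoin (ZMod p) {x', y'})
    (hym : y ∈ IntermediateField.adjoin (ZMod p) {x', y'}) :
    ∃ σ : F ≃ₐ[ZMod p] F, σ x = x' ∧ σ y = y' := by
  obtain ⟨σ, h1, h2⟩ := exists_algHom hx hrel hgen hx' hrel'
  have hle : IntermediateField.adjoin (ZMod p) {x', y'} ≤ σ.fieldRange := by
    rw [IntermediateField.adjoin_le_iff]
    rintro _ (rfl | rfl)
    · exact ⟨x, h1⟩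
    · exact ⟨y, h2⟩
  have hsurj : Function.Surjective σ := by
    rw [← AlgHom.fieldRange_eq_top, eq_top_iff, ← hgen, IntermediateField.adjoin_le_iff]
    rintro _ (rfl | rfl)
    · exact hle hxm
    · exact hle hym
  exact ⟨AlgEquiv.ofBijective σ ⟨σ.injective, hsurj⟩, h1, h2⟩

end Curve

/-- The homomorphism from a dihedral group determined by the images of the rotations and of a
reflection. -/
def DihedralGroup.liftHom {n : ℕ} {H : Type*} [Group H] (ρ : Multiplicative (ZMod n) →* H) (s : H)
    (hs : s * s = 1) (hρ : ∀ i, s * ρ i * s = (ρ i)⁻¹) : DihedralGroup n →* H :=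
  have hcomm (i) : ρ i * s = s * (ρ i)⁻¹ := by
    rw [← hρ, ← mul_assoc, ← mul_assoc, hs, one_mul]
  MonoidHom.mk'
    (fun
      | .r i => ρ (.ofAdd i)
      | .sr i => s * ρ (.ofAdd i))
    (by
      rintro (i | i) (j | j)
      · simp only [DihedralGroup.r_mul_r, ofAdd_add, map_mul]
      · simp only [DihedralGroup.r_mul_sr, ofAdd_sub, map_div]
        rw [← mul_assoc, hcomm, mul_assoc, ← map_inv, ← map_mul, ← map_div, mul_comm,
          div_eq_mul_inv]
      · simp only [DihedralGroup.sr_mul_r, ofAdd_add, map_mul, mul_assoc]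
      · simp only [DihedralGroup.sr_mul_sr, ofAdd_sub, map_div]
        rw [← mul_assoc, mul_assoc s, hcomm, ← mul_assoc, hs, one_mul, ← map_inv, ← map_mul,
          ← map_div, mul_comm, div_eq_mul_inv])

namespace ArtinMumford

variable {p : ℕ} [hp : Fact p.Prime]

/-- The diagonal action of `d` on the translations of the plane over `F_p` by
`(a, b) ↦ (d⁻¹ * a, d * b)`. -/
def scaling : (ZMod p)ˣ →* MulAut (Multiplicative (ZMod p × ZMod p)) where
  toFun d := AddEquiv.toMultiplicative
    (AddEquiv.prodCongr (DistribMulAction.toAddEquiv (ZMod p) d⁻¹)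
      (DistribMulAction.toAddEquiv (ZMod p) d))
  map_one' := by
    refine MulEquiv.ext fun x => ?_
    change Multiplicative.ofAdd ((1 : (ZMod p)ˣ)⁻¹ • x.toAdd.1, (1 : (ZMod p)ˣ) • x.toAdd.2) = x
    rw [inv_one, one_smul, one_smul]
    rfl
  map_mul' d e := by
    refine MulEquiv.ext fun x => ?_
    change Multiplicative.ofAdd ((d * e)⁻¹ • x.toAdd.1, (d * e) • x.toAdd.2)
      = Multiplicative.ofAdd (d⁻¹ • e⁻¹ • x.toAdd.1, d • e • x.toAdd.2)
    rw [mul_inv, mul_smul, mul_smul]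

/-- The exchange of the two coordinates of a translation. -/
def swapping : MulAut (Multiplicative (ZMod p × ZMod p)) :=
  AddEquiv.toMultiplicative AddEquiv.prodComm

lemma swapping_mul_self : (swapping (p := p)) * swapping = 1 := rfl

lemma swapping_mul_scaling (d : (ZMod p)ˣ) :
    swapping * scaling d * swapping = (scaling d)⁻¹ := by
  rw [← map_inv]
  refine MulEquiv.ext fun x => ?_
  change Multiplicative.ofAdd (d • x.toAdd.1, d⁻¹ • x.toAdd.2)
    = Multiplicative.ofAdd (d⁻¹⁻¹ • x.toAdd.1, d⁻¹ • x.toAdd.2)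
  rw [inv_inv]

lemma exists_mulEquiv_closure {H : Type*} [Group H]
    (T : Multiplicative (ZMod p × ZMod p) →* H) (μ : H) (Θ : (ZMod p)ˣ →* H) (hμ : μ * μ = 1)
    (hμΘ : ∀ d, μ * Θ d * μ = (Θ d)⁻¹) (hΘT : ∀ d n, Θ d * T n = T (scaling d n) * Θ d)
    (hμT : ∀ n, μ * T n = T (swapping n) * μ)
    (hinj : ∀ n d, T n * Θ d = 1 → n = 1 ∧ d = 1) (hne : ∀ n d, T n * (μ * Θ d) ≠ 1) :
    ∃ φ : DihedralGroup (p - 1) →* MulAut (Multiplicative (ZMod p × ZMod p)),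
      Nonempty (Subgroup.closure
          ((Set.range fun n : ZMod p × ZMod p => T (.ofAdd n)) ∪ {μ} ∪ Set.range Θ)
        ≃* SemidirectProduct (Multiplicative (ZMod p × ZMod p)) (DihedralGroup (p - 1)) φ) := by
  have hcard : Nat.card (ZMod p)ˣ = p - 1 := by
    rw [Nat.card_eq_fintype_card, ZMod.card_units]
  obtain ⟨e⟩ : Nonempty (Multiplicative (ZMod (p - 1)) ≃* (ZMod p)ˣ) :=
    hcard ▸ ⟨zmodCyclicMulEquiv inferInstance⟩
  let φ := DihedralGroup.liftHom (scaling.comp e.toMonoidHom) swapping swapping_mul_self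
    fun i => swapping_mul_scaling (e i)
  let fg := DihedralGroup.liftHom (Θ.comp e.toMonoidHom) μ hμ fun i => hμΘ (e i)
  have hcompat (g : DihedralGroup (p - 1)) :
      T.comp (φ g).toMonoidHom = (MulAut.conj (fg g)).toMonoidHom.comp T := by
    refine MonoidHom.ext fun n => ?_
    change T (φ g n) = fg g * T n * (fg g)⁻¹
    rw [eq_mul_inv_iff_mul_eq]
    rcases g with i | i
    · exact (hΘT (e (.ofAdd i)) n).symm
    · change T (swapping (scaling (e (.ofAdd i)) n)) * (μ * Θ (e (.ofAdd i)))
        = μ * Θ (e (.ofAdd i)) * T n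
      rw [mul_assoc, hΘT, ← mul_assoc, ← mul_assoc, hμT]
  let L := SemidirectProduct.lift T fg hcompat
  have hL : Function.Injective L := by
    rw [injective_iff_map_eq_one]
    rintro ⟨n, i | i⟩ h
    · obtain ⟨rfl, hi⟩ := hinj n (e (.ofAdd i)) h
      obtain rfl : i = 0 := (map_eq_one_iff e e.injective).1 hi
      rfl
    · exact (hne n (e (.ofAdd i)) h).elim
  have hrange : L.range = Subgroup.closure
      ((Set.range fun n : ZMod p × ZMod p => T (.ofAdd n)) ∪ {μ} ∪ Set.range Θ) := by
    apply le_antisymm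
    · rintro _ ⟨⟨n, g⟩, rfl⟩
      have hΘ (i) : Θ (e i) ∈ Subgroup.closure
          ((Set.range fun n : ZMod p × ZMod p => T (.ofAdd n)) ∪ {μ} ∪ Set.range Θ) :=
        Subgroup.subset_closure (.inr ⟨_, rfl⟩)
      refine mul_mem (Subgroup.subset_closure (.inl (.inl ⟨n.toAdd, rfl⟩))) ?_
      rcases g with i | i
      · exact hΘ _
      · exact mul_mem (Subgroup.subset_closure (.inl (.inr rfl))) (hΘ _)
    · rw [Subgroup.closure_le]
      rintro _ ((⟨n, rfl⟩ | h) | ⟨d, rfl⟩)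
      · exact ⟨.inl (.ofAdd n), SemidirectProduct.lift_inl ..⟩
      · rw [Set.mem_singleton_iff.1 h]
        refine ⟨.inr (.sr 0), (SemidirectProduct.lift_inr ..).trans ?_⟩
        change μ * Θ (e 1) = μ
        rw [map_one, map_one, mul_one]
      · refine ⟨.inr (.r (e.symm d).toAdd), (SemidirectProduct.lift_inr ..).trans ?_⟩
        change Θ (e (e.symm d)) = Θ d
        rw [e.apply_symm_apply]
  exact ⟨φ, ⟨((MonoidHom.ofInjective hL).trans (MulEquiv.subgroupCongr hrange)).symm⟩⟩

end ArtinMumford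

namespace ArtinMumford

variable {p : ℕ} [hp : Fact p.Prime] {F : Type*} [Field F] [Algebra (ZMod p) F] {x y : F}

lemma transcendental_of_pow_sub {z : F} (h : Transcendental (ZMod p) (z ^ p - z)) :
    Transcendental (ZMod p) z :=
  fun hz => h ((hz.pow p).sub hz)

lemma transcendental_pow_sub {z : F} (h : Transcendental (ZMod p) z) :
    Transcendental (ZMod p) (z ^ p - z) := by
  have := h.aeval_of_transcendental (f := Polynomial.X ^ p - Polynomial.X)
    (Polynomial.transcendental _ (by
      rw [FiniteField.X_pow_card_sub_X_natDegree_eq (ZMod p) hp.out.one_lt]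
      exact hp.out.ne_zero)
      (mem_nonZeroDivisors_of_ne_zero (Polynomial.leadingCoeff_ne_zero.2
        (FiniteField.X_pow_card_sub_X_ne_zero (ZMod p) hp.out.one_lt))))
  simpa using this

lemma transcendental_snd (hx : Transcendental (ZMod p) x)
    (hrel : (x ^ p - x) * (y ^ p - y) = 1) : Transcendental (ZMod p) y := by
  refine transcendental_of_pow_sub fun h => transcendental_pow_sub hx ?_
  rw [eq_inv_of_mul_eq_one_left hrel]
  exact h.inv

lemma pow_sub_add_algebraMap (z : F) (a : ZMod p) :
    (z + algebraMap (ZMod p) F a) ^ p - (z + algebraMap (ZMod p) F a) = z ^ p - z := by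
  have : CharP F p := charP_of_injective_algebraMap (algebraMap (ZMod p) F).injective p
  rw [add_pow_char, ← map_pow, ZMod.pow_card]
  ring

lemma pow_sub_algebraMap_mul (z : F) (a : ZMod p) :
    (algebraMap (ZMod p) F a * z) ^ p - algebraMap (ZMod p) F a * z
      = algebraMap (ZMod p) F a * (z ^ p - z) := by
  rw [mul_pow, ← map_pow, ZMod.pow_card]
  ring

lemma algebraMap_unit_mul_inv (d : (ZMod p)ˣ) :
    algebraMap (ZMod p) F d * algebraMap (ZMod p) F ((d⁻¹ : (ZMod p)ˣ) : ZMod p) = 1 := by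
  rw [← map_mul, Units.mul_inv, map_one]

lemma mul_rel_translate (hrel : (x ^ p - x) * (y ^ p - y) = 1) (a b : ZMod p) :
    ((x + algebraMap (ZMod p) F a) ^ p - (x + algebraMap (ZMod p) F a))
      * ((y + algebraMap (ZMod p) F b) ^ p - (y + algebraMap (ZMod p) F b)) = 1 := by
  rw [pow_sub_add_algebraMap, pow_sub_add_algebraMap, hrel]

lemma mul_rel_scale (hrel : (x ^ p - x) * (y ^ p - y) = 1) (d : (ZMod p)ˣ) :
    ((algebraMap (ZMod p) F d * x) ^ p - algebraMap (ZMod p) F d * x)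
      * ((algebraMap (ZMod p) F ((d⁻¹ : (ZMod p)ˣ) : ZMod p) * y) ^ p
        - algebraMap (ZMod p) F ((d⁻¹ : (ZMod p)ˣ) : ZMod p) * y) = 1 := by
  rw [pow_sub_algebraMap_mul, pow_sub_algebraMap_mul, mul_mul_mul_comm, hrel,
    algebraMap_unit_mul_inv, mul_one]

lemma algEquiv_ext (hgen : IntermediateField.adjoin (ZMod p) {x, y} = ⊤)
    {σ τ : F ≃ₐ[ZMod p] F} (h1 : σ x = τ x) (h2 : σ y = τ y) : σ = τ :=
  AlgEquiv.coe_toAlgHom_injective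
    (algHom_ext hgen (σ := σ.toAlgHom) (τ := τ.toAlgHom) h1 h2)

lemma exists_translate (hx : Transcendental (ZMod p) x)
    (hrel : (x ^ p - x) * (y ^ p - y) = 1)
    (hgen : IntermediateField.adjoin (ZMod p) {x, y} = ⊤) (a b : ZMod p) :
    ∃ σ : F ≃ₐ[ZMod p] F,
      σ x = x + algebraMap (ZMod p) F a ∧ σ y = y + algebraMap (ZMod p) F b := by
  refine exists_algEquiv hx hrel hgen ?_ (mul_rel_translate hrel a b) ?_ ?_
  · exact fun h => hx (by simpa using h.sub (isAlgebraic_algebraMap a))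
  · rw [← add_sub_cancel_right x (algebraMap (ZMod p) F a)]
    exact sub_mem (IntermediateField.subset_adjoin _ _ (by simp))
      (IntermediateField.algebraMap_mem _ _)
  · rw [← add_sub_cancel_right y (algebraMap (ZMod p) F b)]
    exact sub_mem (IntermediateField.subset_adjoin _ _ (by simp))
      (IntermediateField.algebraMap_mem _ _)

lemma exists_swap (hx : Transcendental (ZMod p) x)
    (hrel : (x ^ p - x) * (y ^ p - y) = 1)
    (hgen : IntermediateField.adjoin (ZMod p) {x, y} = ⊤) :
    ∃ σ : F ≃ₐ[ZMod p] F, σ x = y ∧ σ y = x :=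
  exists_algEquiv hx hrel hgen (transcendental_snd hx hrel) ((mul_comm _ _).trans hrel)
    (IntermediateField.subset_adjoin _ _ (by simp))
    (IntermediateField.subset_adjoin _ _ (by simp))

lemma exists_scale (hx : Transcendental (ZMod p) x)
    (hrel : (x ^ p - x) * (y ^ p - y) = 1)
    (hgen : IntermediateField.adjoin (ZMod p) {x, y} = ⊤) (d : (ZMod p)ˣ) :
    ∃ σ : F ≃ₐ[ZMod p] F, σ x = algebraMap (ZMod p) F d * x
      ∧ σ y = algebraMap (ZMod p) F ((d⁻¹ : (ZMod p)ˣ) : ZMod p) * y := by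
  have hd := algebraMap_unit_mul_inv (F := F) d
  have hd' : algebraMap (ZMod p) F ((d⁻¹ : (ZMod p)ˣ) : ZMod p) * (algebraMap (ZMod p) F d * x)
      = x := by linear_combination x * hd
  refine exists_algEquiv hx hrel hgen ?_ (mul_rel_scale hrel d) ?_ ?_
  · intro h
    exact hx (hd' ▸ (isAlgebraic_algebraMap _).mul h)
  · have := mul_mem (IntermediateField.algebraMap_mem _ ((d⁻¹ : (ZMod p)ˣ) : ZMod p))
      (IntermediateField.subset_adjoin (ZMod p) {algebraMap (ZMod p) F d * x,
        algebraMap (ZMod p) F ((d⁻¹ : (ZMod p)ˣ) : ZMod p) * y} (Set.mem_insert _ _))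
    rwa [hd'] at this
  · have := mul_mem (IntermediateField.algebraMap_mem _ (d : ZMod p))
      (IntermediateField.subset_adjoin (ZMod p) {algebraMap (ZMod p) F d * x,
        algebraMap (ZMod p) F ((d⁻¹ : (ZMod p)ˣ) : ZMod p) * y}
        (Set.mem_insert_of_mem _ rfl))
    rwa [← mul_assoc, hd, one_mul] at this

/-- A transcendental element is fixed by no affine map over `F_p` other than the identity. -/
lemma eq_of_affine_fixed (hx : Transcendental (ZMod p) x) {a c : ZMod p}
    (h : algebraMap (ZMod p) F c * x + algebraMap (ZMod p) F a = x) : a = 0 ∧ c = 1 := by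
  have hc : c = 1 := by
    by_contra hc
    have hc' : algebraMap (ZMod p) F (1 - c) ≠ 0 := by
      rw [map_ne_zero]
      exact sub_ne_zero.2 (Ne.symm hc)
    refine hx ?_
    have : x = algebraMap (ZMod p) F (a / (1 - c)) := by
      rw [map_div₀, eq_div_iff hc', map_sub, map_one]
      linear_combination -h
    rw [this]
    exact isAlgebraic_algebraMap _
  subst hc
  refine ⟨?_, rfl⟩
  rw [map_one, one_mul, add_eq_left] at h
  exact (map_eq_zero _).1 h

/-- The coordinates of a generic point are not related by an affine map over `F_p`. -/
lemma affine_ne (hx : Transcendental (ZMod p) x) (hrel : (x ^ p - x) * (y ^ p - y) = 1)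
    (a c : ZMod p) : algebraMap (ZMod p) F c * x + algebraMap (ZMod p) F a ≠ y := by
  rintro rfl
  rw [pow_sub_add_algebraMap, pow_sub_algebraMap_mul] at hrel
  refine transcendental_pow_sub hx (IsAlgebraic.of_pow two_pos ?_)
  have : (x ^ p - x) ^ 2 = algebraMap (ZMod p) F c⁻¹ := by
    rw [map_inv₀]
    refine eq_inv_of_mul_eq_one_left ?_
    linear_combination hrel
  rw [this]
  exact isAlgebraic_algebraMap _

end ArtinMumford


/-- Let `p` be an odd prime and `F = F_p(x,y)` the function
field of the Artin–Mumford curve, with `(x^p−x)(y^p−y) = 1`. The maps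
`τ_{a,b} : (x,y) ↦ (x+a, y+b)` (`a,b ∈ F_p`), `μ : (x,y) ↦ (y,x)` and
`θ_d : (x,y) ↦ (dx, d⁻¹y)` (`d ∈ F_p^*`) preserve the defining equation and
induce automorphisms of `F` over `F_p`; moreover the group they generate has
order `p²·2(p−1)` and is isomorphic to `(C_p × C_p) ⋊ D_{p−1}`. -/
theorem stmt_10 (p : ℕ) [Fact p.Prime] (hodd : p ≠ 2)
    (F : Type*) [Field F] [Algebra (ZMod p) F]
    (x y : F) (hx : Transcendental (ZMod p) x)
    (hrel : (x ^ p - x) * (y ^ p - y) = 1)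
    (hgen : IntermediateField.adjoin (ZMod p) {x, y} = ⊤) :
    (∀ a b : ZMod p,
        ((x + algebraMap (ZMod p) F a) ^ p - (x + algebraMap (ZMod p) F a))
          * ((y + algebraMap (ZMod p) F b) ^ p - (y + algebraMap (ZMod p) F b)) = 1)
    ∧ ((y ^ p - y) * (x ^ p - x) = 1)
    ∧ (∀ d : (ZMod p)ˣ,
        ((algebraMap (ZMod p) F d * x) ^ p - algebraMap (ZMod p) F d * x)
          * ((algebraMap (ZMod p) F ((d⁻¹ : (ZMod p)ˣ) : ZMod p) * y) ^ p
              - algebraMap (ZMod p) F ((d⁻¹ : (ZMod p)ˣ) : ZMod p) * y) = 1)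
    ∧ ∃ (T : ZMod p → ZMod p → (F ≃ₐ[ZMod p] F)) (μ : F ≃ₐ[ZMod p] F)
        (Θ : (ZMod p)ˣ → (F ≃ₐ[ZMod p] F)),
        (∀ a b : ZMod p, (T a b) x = x + algebraMap (ZMod p) F a
            ∧ (T a b) y = y + algebraMap (ZMod p) F b)
        ∧ (μ x = y ∧ μ y = x)
        ∧ (∀ d : (ZMod p)ˣ, (Θ d) x = algebraMap (ZMod p) F d * x
            ∧ (Θ d) y = algebraMap (ZMod p) F ((d⁻¹ : (ZMod p)ˣ) : ZMod p) * y)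
        ∧ Nat.card (Subgroup.closure
            ((Set.range fun ab : ZMod p × ZMod p => T ab.1 ab.2)
              ∪ {μ} ∪ Set.range Θ)) = p ^ 2 * (2 * (p - 1))
        ∧ ∃ φ : DihedralGroup (p - 1) →* MulAut (Multiplicative (ZMod p × ZMod p)),
            Nonempty (↥(Subgroup.closure
              ((Set.range fun ab : ZMod p × ZMod p => T ab.1 ab.2)
                ∪ {μ} ∪ Set.range Θ))
              ≃* SemidirectProduct (Multiplicative (ZMod p × ZMod p))
                  (DihedralGroup (p - 1)) φ) := by
  choose T hTx hTy using ArtinMumford.exists_translate hx hrel hgen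
  obtain ⟨μ, hμx, hμy⟩ := ArtinMumford.exists_swap hx hrel hgen
  choose Θ hΘx hΘy using ArtinMumford.exists_scale hx hrel hgen
  have hy := ArtinMumford.transcendental_snd hx hrel
  let T' : Multiplicative (ZMod p × ZMod p) →* (F ≃ₐ[ZMod p] F) :=
    MonoidHom.mk' (fun n => T n.toAdd.1 n.toAdd.2) fun m n =>
      ArtinMumford.algEquiv_ext hgen
        (by simp only [AlgEquiv.mul_apply, hTx, map_add, AlgEquiv.commutes, toAdd_mul,
              Prod.fst_add]; ring)
        (by simp only [AlgEquiv.mul_apply, hTy, map_add, AlgEquiv.commutes, toAdd_mul,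
              Prod.snd_add]; ring)
  let Θ' : (ZMod p)ˣ →* (F ≃ₐ[ZMod p] F) :=
    MonoidHom.mk' Θ fun d e =>
      ArtinMumford.algEquiv_ext hgen
        (by simp only [AlgEquiv.mul_apply, hΘx, map_mul, AlgEquiv.commutes, Units.val_mul]; ring)
        (by simp only [AlgEquiv.mul_apply, hΘy, map_mul, AlgEquiv.commutes, mul_inv,
              Units.val_mul]; ring)
  have hiso := ArtinMumford.exists_mulEquiv_closure T' μ Θ'
    (ArtinMumford.algEquiv_ext hgen
      (by simp only [AlgEquiv.mul_apply, AlgEquiv.one_apply, hμx, hμy])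
      (by simp only [AlgEquiv.mul_apply, AlgEquiv.one_apply, hμx, hμy]))
    (fun d => by
      rw [← map_inv]
      refine ArtinMumford.algEquiv_ext hgen ?_ ?_
      · change μ (Θ d (μ x)) = Θ d⁻¹ x
        simp only [hμx, hμy, hΘx, hΘy, map_mul, AlgEquiv.commutes]
      · change μ (Θ d (μ y)) = Θ d⁻¹ y
        simp only [hμx, hμy, hΘx, hΘy, map_mul, AlgEquiv.commutes, inv_inv])
    (fun d n => by
      refine ArtinMumford.algEquiv_ext hgen ?_ ?_
      · change Θ d (T n.toAdd.1 n.toAdd.2 x)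
          = T (d⁻¹ * n.toAdd.1 : ZMod p) (d * n.toAdd.2) (Θ d x)
        simp only [hTx, hΘx, map_add, map_mul, AlgEquiv.commutes]
        linear_combination -algebraMap (ZMod p) F n.toAdd.1
          * ArtinMumford.algebraMap_unit_mul_inv (F := F) d
      · change Θ d (T n.toAdd.1 n.toAdd.2 y)
          = T (d⁻¹ * n.toAdd.1 : ZMod p) (d * n.toAdd.2) (Θ d y)
        simp only [hTy, hΘy, map_add, map_mul, AlgEquiv.commutes]
        linear_combination -algebraMap (ZMod p) F n.toAdd.2
          * ArtinMumford.algebraMap_unit_mul_inv (F := F) d)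
    (fun n => by
      refine ArtinMumford.algEquiv_ext hgen ?_ ?_
      · change μ (T n.toAdd.1 n.toAdd.2 x) = T n.toAdd.2 n.toAdd.1 (μ x)
        simp only [hTx, hTy, hμx, map_add, AlgEquiv.commutes]
      · change μ (T n.toAdd.1 n.toAdd.2 y) = T n.toAdd.2 n.toAdd.1 (μ y)
        simp only [hTx, hTy, hμy, map_add, AlgEquiv.commutes])
    (fun n d h => by
      have h1 : T n.toAdd.1 n.toAdd.2 (Θ d x) = x := DFunLike.congr_fun h x
      have h2 : T n.toAdd.1 n.toAdd.2 (Θ d y) = y := DFunLike.congr_fun h y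
      rw [hΘx, map_mul, AlgEquiv.commutes, hTx, mul_add, ← map_mul] at h1
      rw [hΘy, map_mul, AlgEquiv.commutes, hTy, mul_add, ← map_mul] at h2
      obtain ⟨ha, hd⟩ := ArtinMumford.eq_of_affine_fixed hx h1
      obtain ⟨hb, -⟩ := ArtinMumford.eq_of_affine_fixed hy h2
      rw [Units.mul_right_eq_zero] at ha hb
      exact ⟨Multiplicative.toAdd.injective (Prod.ext ha hb), Units.ext hd⟩)
    (fun n d h => by
      have h2 : T n.toAdd.1 n.toAdd.2 (μ (Θ d y)) = y := DFunLike.congr_fun h y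
      rw [hΘy, map_mul, AlgEquiv.commutes, hμy, map_mul, AlgEquiv.commutes, hTx, mul_add,
        ← map_mul] at h2
      exact ArtinMumford.affine_ne hx hrel _ _ h2)
  refine ⟨ArtinMumford.mul_rel_translate hrel, (mul_comm _ _).trans hrel,
    ArtinMumford.mul_rel_scale hrel, T, μ, Θ, fun a b => ⟨hTx a b, hTy a b⟩, ⟨hμx, hμy⟩,
    fun d => ⟨hΘx d, hΘy d⟩, ?_, hiso⟩
  obtain ⟨φ, ⟨e⟩⟩ := hiso
  refine (Nat.card_congr e.toEquiv).trans ?_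
  rw [Nat.card_congr SemidirectProduct.equivProd, Nat.card_prod, DihedralGroup.nat_card,
    Nat.card_congr Multiplicative.toAdd, Nat.card_prod, Nat.card_zmod, sq]
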